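/- There exists a constant C > 0, independent of δ, x, p and μ, such that for every δ > 0, x ∈ 𝕋^d, p ∈ ℝ^d, μ ∈ P(𝕋^d) and every classical (C²) solution v of the discounted cell problem δv(y) − tr(a D²v(y)) + H(x, y, p, Dv(y), μ) = 0 on 𝕋^d, one has sup_{y∈𝕋^d} |v(y) − v(0)| ≤ C(1 + λ(p) + |p|), where λ(p) := sup_{x,y,μ} |H(x, y, p, 0, μ)| and 0 denotes the image of the origin in 𝕋^d. -/

import Mathlib

noncomputable section

open MeasureTheory Metric Filter
open scoped RealInnerProductSpace ENNReal Topology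

instance : Fact ((0:ℝ) < 1) := ⟨one_pos⟩

/-- Euclidean space `ℝ^d`. -/
abbrev Euc (d : ℕ) := EuclideanSpace ℝ (Fin d)

/-- The flat torus `𝕋^d = ℝ^d/ℤ^d`, realized as a product of circles. -/
abbrev Torus (d : ℕ) := Fin d → AddCircle (1 : ℝ)

/-- Canonical projection `ℝ^d → 𝕋^d`. -/
def Torus.proj {d : ℕ} (y : Euc d) : Torus d := fun i => (y i : AddCircle (1 : ℝ))

/-- The 1-Wasserstein distance between two (probability) measures on a metric
measurable space: the infimum over all couplings of the expected distance. -/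
def W1 {X : Type*} [MeasurableSpace X] [PseudoMetricSpace X] (μ ν : Measure X) : ℝ :=
  ⨅ π : {π : Measure (X × X) //
      IsProbabilityMeasure π ∧ π.map Prod.fst = μ ∧ π.map Prod.snd = ν},
    ∫ z, dist z.1 z.2 ∂(π : Measure (X × X))

/-- `P(𝕋^d)`: Borel probability measures on the torus. -/
abbrev ProbT (d : ℕ) := ProbabilityMeasure (Torus d)

/-- 1-Wasserstein distance on `P(𝕋^d)`. -/
def W1T {d : ℕ} (μ ν : ProbT d) : ℝ := W1 (μ : Measure (Torus d)) (ν : Measure (Torus d))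

/-- Second partial derivative `∂²v/∂yᵢ∂yⱼ`. -/
def hess {d : ℕ} (v : Euc d → ℝ) (y : Euc d) (i j : Fin d) : ℝ :=
  iteratedFDeriv ℝ 2 v y ![EuclideanSpace.single i 1, EuclideanSpace.single j 1]

/-- `tr(a D²v)(y)` for a constant matrix `a`. -/
def trAH {d : ℕ} (a : Matrix (Fin d) (Fin d) ℝ) (v : Euc d → ℝ) (y : Euc d) : ℝ :=
  ∑ i, ∑ j, a i j * hess v y j i

/-- The `ℤ^d`-periodic lift of a function on the torus. -/
def tlift {d : ℕ} (v : Torus d → ℝ) : Euc d → ℝ := fun y => v (Torus.proj y)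

/-- `v : 𝕋^d → ℝ` is a classical (C²) solution of the discounted cell problem
`δ v(y) - tr(a D²v(y)) + H(x, y, p, Dv(y), μ) = 0` on `𝕋^d`. -/
def IsSol {d : ℕ} (a : Matrix (Fin d) (Fin d) ℝ)
    (H : Torus d → Torus d → Euc d → Euc d → ProbT d → ℝ)
    (δ : ℝ) (x : Torus d) (p : Euc d) (μ : ProbT d) (v : Torus d → ℝ) : Prop :=
  ContDiff ℝ 2 (tlift v) ∧
  ∀ y : Euc d,
    δ * v (Torus.proj y) - trAH a (tlift v) y
      + H x (Torus.proj y) p (gradient (tlift v) y) μ = 0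


theorem second_deriv_nonpos_of_isLocalMax {g g' : ℝ → ℝ} {g'' t₀ : ℝ}
    (h1 : ∀ t, HasDerivAt g (g' t) t) (h2 : HasDerivAt g' g'' t₀) (hm : IsLocalMax g t₀) :
    g'' ≤ 0 := by
  by_contra! hpos
  have e1 : deriv g = g' := funext fun t => (h1 t).deriv
  have hmin : IsLocalMin g t₀ :=
    isLocalMin_of_deriv_deriv_pos (by rw [e1, h2.deriv]; exact hpos) hm.deriv_eq_zero
      (h1 t₀).continuousAt
  have hconst : g =ᶠ[𝓝 t₀] fun _ => g t₀ := by
    filter_upwards [hm, hmin] with t h h' using le_antisymm h h'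
  have h3 := hconst.deriv.deriv_eq
  rw [e1, h2.deriv] at h3
  simp at h3
  exact hpos.ne' h3

theorem exists_pos_mul_sq_norm_le {d : ℕ} {a : Matrix (Fin d) (Fin d) ℝ} (ha : a.PosDef) :
    ∃ κ : ℝ, 0 < κ ∧ ∀ e : Euc d, κ * ‖e‖ ^ 2 ≤ e.ofLp ⬝ᵥ a.mulVec e.ofLp := by
  have hcont : Continuous fun e : Euc d => e.ofLp ⬝ᵥ a.mulVec e.ofLp := by
    simp only [dotProduct, Matrix.mulVec]
    fun_prop
  obtain ⟨κ, hκ, h⟩ := (isCompact_sphere (0 : Euc d) 1).exists_forall_le' hcont.continuousOn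
    (a := 0) fun e he => by
      have hne : e ≠ 0 := by rintro rfl; simp at he
      have := ha.dotProduct_mulVec_pos (x := e.ofLp) (by simpa using hne)
      simpa using this
  refine ⟨κ, hκ, fun e => ?_⟩
  rcases eq_or_ne e 0 with rfl | hne
  · simp
  have hn : 0 < ‖e‖ := norm_pos_iff.2 hne
  have := h (‖e‖⁻¹ • e) (by simp [norm_smul, hn.ne'])
  simp only [WithLp.ofLp_smul, Matrix.mulVec_smul, smul_dotProduct, dotProduct_smul,
    smul_eq_mul] at this
  have h2 := mul_le_mul_of_nonneg_right this (sq_nonneg ‖e‖)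
  refine h2.trans_eq ?_
  field_simp

theorem trace_mul_nonneg_of_posSemidef {d : ℕ} {P N : Matrix (Fin d) (Fin d) ℝ}
    (hP : P.PosSemidef) (hN : N.PosSemidef) : 0 ≤ (P * N).trace := by
  open scoped MatrixOrder Matrix.Norms.L2Operator in
  obtain ⟨B, rfl⟩ := CStarAlgebra.nonneg_iff_eq_star_mul_self.mp hP.nonneg
  rw [Matrix.mul_assoc, Matrix.trace_mul_comm]
  exact (hN.mul_mul_conjTranspose_same B).trace_nonneg

theorem mul_dotProduct_le_trace_mul {d : ℕ} {a N : Matrix (Fin d) (Fin d) ℝ} {κ : ℝ}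
    (ha : a.IsSymm) (hκ0 : 0 ≤ κ)
    (hκ : ∀ e : Euc d, κ * ‖e‖ ^ 2 ≤ e.ofLp ⬝ᵥ a.mulVec e.ofLp)
    (hN : N.PosSemidef) (e : Euc d) (he : ‖e‖ = 1) :
    κ * (e.ofLp ⬝ᵥ N.mulVec e.ofLp) ≤ (a * N).trace := by
  have hP : (a - κ • Matrix.vecMulVec e.ofLp e.ofLp).PosSemidef := by
    refine .of_dotProduct_mulVec_nonneg ?_ fun η => ?_
    · ext i j
      simp [Matrix.vecMulVec_apply, ha.apply i j, mul_comm]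
    · have h1 := hκ (WithLp.toLp 2 η)
      have h2 : (e.ofLp ⬝ᵥ η) ^ 2 ≤ ‖WithLp.toLp 2 η‖ ^ 2 := by
        have := abs_real_inner_le_norm e (WithLp.toLp 2 η)
        rw [he, one_mul] at this
        have h3 := sq_le_sq' (neg_le_of_abs_le this) (le_of_abs_le this)
        rwa [EuclideanSpace.inner_eq_star_dotProduct, star_trivial, dotProduct_comm] at h3
      have h4 : η ⬝ᵥ Matrix.mulVec (Matrix.vecMulVec e.ofLp e.ofLp) η = (e.ofLp ⬝ᵥ η) ^ 2 := by
        rw [Matrix.vecMulVec_mulVec]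
        simp [dotProduct_comm, sq]
      simp only [star_trivial, Matrix.sub_mulVec, Matrix.smul_mulVec, dotProduct_sub,
        dotProduct_smul, smul_eq_mul, h4]
      simp only at h1
      nlinarith
  have h := trace_mul_nonneg_of_posSemidef hP hN
  rw [Matrix.sub_mul, Matrix.trace_sub, Matrix.smul_mul, Matrix.trace_smul,
    Matrix.vecMulVec_mul, Matrix.trace_vecMulVec, Matrix.dotProduct_mulVec] at *
  rw [dotProduct_comm]
  simp only [smul_eq_mul] at h
  rw [dotProduct_comm] at h
  rw [dotProduct_comm]
  linarith

theorem hess_eq {d : ℕ} (w : Euc d → ℝ) (y : Euc d) (i j : Fin d) :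
    hess w y i j = fderiv ℝ (fderiv ℝ w) y (EuclideanSpace.single i 1)
      (EuclideanSpace.single j 1) := by
  simp [hess, iteratedFDeriv_two_apply]

theorem dotProduct_hess_mulVec {d : ℕ} (w : Euc d → ℝ) (y e : Euc d) :
    e.ofLp ⬝ᵥ (Matrix.of (hess w y)).mulVec e.ofLp = fderiv ℝ (fderiv ℝ w) y e e := by
  have he : e = ∑ i, e i • EuclideanSpace.single i (1 : ℝ) := by
    ext j
    simp [Pi.single_apply]
  conv_rhs => rw [he]
  simp only [dotProduct, Matrix.mulVec, map_sum, map_smul, sum_apply,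
    smul_apply, smul_eq_mul, Matrix.of_apply, hess_eq, Finset.mul_sum]
  rw [Finset.sum_comm]
  refine Finset.sum_congr rfl fun i _ => Finset.sum_congr rfl fun j _ => by ring

theorem hess_symm {d : ℕ} {w : Euc d → ℝ} (hw : ContDiff ℝ 2 w) (y : Euc d) (i j : Fin d) :
    hess w y i j = hess w y j i := by
  rw [hess_eq, hess_eq]
  exact (hw.contDiffAt.isSymmSndFDerivAt (by simp)).eq _ _

theorem trAH_eq_trace {d : ℕ} (a : Matrix (Fin d) (Fin d) ℝ) (w : Euc d → ℝ) (y : Euc d) :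
    trAH a w y = (a * Matrix.of (hess w y)).trace := by
  simp [trAH, Matrix.trace, Matrix.mul_apply]

theorem hasDerivAt_line {d : ℕ} {w : Euc d → ℝ} (hw : ContDiff ℝ 2 w) (x η : Euc d) (t : ℝ) :
    HasDerivAt (fun t : ℝ => w (x + t • η)) (fderiv ℝ w (x + t • η) η) t := by
  have h1 : HasDerivAt (fun t : ℝ => x + t • η) η t := by
    simpa using ((hasDerivAt_id t).smul_const η).const_add x
  exact ((hw.differentiable (by simp)) _).hasFDerivAt.comp_hasDerivAt t h1

theorem hasDerivAt_fderiv_line {d : ℕ} {w : Euc d → ℝ} (hw : ContDiff ℝ 2 w) (x η : Euc d) :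
    HasDerivAt (fun t : ℝ => fderiv ℝ w (x + t • η) η)
      (fderiv ℝ (fderiv ℝ w) x η η) 0 := by
  have h1 : HasDerivAt (fun t : ℝ => x + t • η) η 0 := by
    simpa using ((hasDerivAt_id (0 : ℝ)).smul_const η).const_add x
  have hw1 : ContDiff ℝ 1 (fderiv ℝ w) := hw.fderiv_right (by norm_num)
  have h2 : HasFDerivAt (fderiv ℝ w) (fderiv ℝ (fderiv ℝ w) x) (x + (0 : ℝ) • η) := by
    simpa using (hw1.differentiable (by simp) x).hasFDerivAt
  have h3 : HasFDerivAt (fun z => fderiv ℝ w z η)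
      ((ContinuousLinearMap.apply ℝ ℝ η).comp (fderiv ℝ (fderiv ℝ w) x)) (x + (0 : ℝ) • η) :=
    (ContinuousLinearMap.apply ℝ ℝ η).hasFDerivAt.comp _ h2
  exact h3.comp_hasDerivAt (0 : ℝ) h1

/-- Maximum principle for the doubled variables: at a maximum of `w x - w y - φ ‖x - y‖` off the
diagonal, the difference of the diffusion terms is controlled by `φ''`. -/
theorem trAH_sub_trAH_le {d : ℕ} {a : Matrix (Fin d) (Fin d) ℝ} {κ : ℝ} (ha : a.IsSymm)
    (hκ0 : 0 ≤ κ) (hκ : ∀ e : Euc d, κ * ‖e‖ ^ 2 ≤ e.ofLp ⬝ᵥ a.mulVec e.ofLp)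
    {w : Euc d → ℝ} (hw : ContDiff ℝ 2 w) {φ φ' : ℝ → ℝ} {φ'' : ℝ} {x y : Euc d} (hxy : x ≠ y)
    (hφ : ∀ t, HasDerivAt φ (φ' t) t) (hφ' : HasDerivAt φ' φ'' ‖x - y‖)
    (hmax : ∀ x' y', w x' - w y' - φ ‖x' - y'‖ ≤ w x - w y - φ ‖x - y‖) :
    trAH a w x - trAH a w y ≤ 4 * κ * φ'' := by
  set r := ‖x - y‖ with hr
  have hr0 : 0 < r := norm_pos_iff.2 (sub_ne_zero.2 hxy)
  set e : Euc d := r⁻¹ • (x - y) with he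
  have he1 : ‖e‖ = 1 := by simp [he, norm_smul, ← hr, abs_of_pos hr0, hr0.ne']
  have hre : x - y = r • e := by simp [he, smul_smul, hr0.ne']
  have hsync : ∀ η : Euc d, fderiv ℝ (fderiv ℝ w) x η η - fderiv ℝ (fderiv ℝ w) y η η ≤ 0 := by
    intro η
    refine second_deriv_nonpos_of_isLocalMax
      (fun t => (hasDerivAt_line hw x η t).sub (hasDerivAt_line hw y η t))
      ((hasDerivAt_fderiv_line hw x η).sub (hasDerivAt_fderiv_line hw y η))
      (Eventually.of_forall fun t => ?_)
    have := hmax (x + t • η) (y + t • η)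
    simp only [add_sub_add_right_eq_sub] at this
    simp
    linarith
  have hrefl : fderiv ℝ (fderiv ℝ w) x e e - fderiv ℝ (fderiv ℝ w) y e e ≤ 4 * φ'' := by
    have hl : ∀ t : ℝ, HasDerivAt (fun t : ℝ => r + 2 * t) 2 t := fun t => by
      simpa using ((hasDerivAt_id t).const_mul 2).const_add r
    have hφ1 : ∀ t : ℝ, HasDerivAt (fun t : ℝ => φ (r + 2 * t)) (φ' (r + 2 * t) * 2) t :=
      fun t => (hφ _).comp t (hl t)
    have hφ2 : HasDerivAt (fun t : ℝ => φ' (r + 2 * t) * 2) (φ'' * 2 * 2) 0 := by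
      have h0 : HasDerivAt φ' φ'' (r + 2 * (0 : ℝ)) := by simpa using hφ'
      exact (h0.comp (0 : ℝ) (hl 0)).mul_const 2
    have h := second_deriv_nonpos_of_isLocalMax (t₀ := 0)
      (fun t => ((hasDerivAt_line hw x e t).sub (hasDerivAt_line hw y (-e) t)).sub (hφ1 t))
      (((hasDerivAt_fderiv_line hw x e).sub (hasDerivAt_fderiv_line hw y (-e))).sub hφ2) ?_
    · simp only [map_neg, neg_apply, neg_neg] at h
      linarith
    · filter_upwards [lt_mem_nhds (show -(r / 2) < (0 : ℝ) by linarith)] with t ht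
      have h1 := hmax (x + t • e) (y + t • -e)
      have h2 : x + t • e - (y + t • -e) = (r + 2 * t) • e := by
        rw [add_smul, ← hre]; module
      rw [h2, norm_smul, he1, mul_one, Real.norm_of_nonneg (by linarith)] at h1
      simpa using h1
  have hN : (Matrix.of (hess w y) - Matrix.of (hess w x)).PosSemidef := by
    refine .of_dotProduct_mulVec_nonneg ?_ fun η => ?_
    · ext i j
      simp [hess_symm hw _ i j]
    · have h1 := hsync (WithLp.toLp 2 η)
      rw [← dotProduct_hess_mulVec, ← dotProduct_hess_mulVec] at h1
      simp only [star_trivial, Matrix.sub_mulVec, dotProduct_sub]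
      simp only at h1
      linarith
  have h := mul_dotProduct_le_trace_mul ha hκ0 hκ hN e he1
  rw [Matrix.mul_sub, Matrix.trace_sub, ← trAH_eq_trace, ← trAH_eq_trace, Matrix.sub_mulVec,
    dotProduct_sub, dotProduct_hess_mulVec, dotProduct_hess_mulVec] at h
  nlinarith

theorem norm_fderiv_le_of_sub_le {E : Type*} [NormedAddCommGroup E] [NormedSpace ℝ E]
    {w : E → ℝ} {x : E} {c : ℝ} (hc : 0 ≤ c) (hw : DifferentiableAt ℝ w x)
    (h : ∀ x', w x' - w x ≤ c * ‖x' - x‖) : ‖fderiv ℝ w x‖ ≤ c := by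
  have key : ∀ η : E, fderiv ℝ w x η ≤ c * ‖η‖ := by
    intro η
    have hd : HasDerivAt (fun t : ℝ => w (x + t • η)) (fderiv ℝ w x η) 0 := by
      have h1 : HasDerivAt (fun t : ℝ => x + t • η) η 0 := by
        simpa using ((hasDerivAt_id (0 : ℝ)).smul_const η).const_add x
      have h2 : HasFDerivAt w (fderiv ℝ w x) (x + (0 : ℝ) • η) := by
        simpa using hw.hasFDerivAt
      exact h2.comp_hasDerivAt (0 : ℝ) h1
    refine le_of_tendsto hd.tendsto_slope_zero_right ?_
    filter_upwards [self_mem_nhdsWithin] with t ht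
    have ht : 0 < t := ht
    have h1 := h (x + t • η)
    rw [add_sub_cancel_left, norm_smul, Real.norm_of_nonneg ht.le] at h1
    simp only [zero_add, zero_smul, add_zero, smul_eq_mul]
    rw [inv_mul_le_iff₀ ht]
    linarith
  refine ContinuousLinearMap.opNorm_le_bound _ hc fun η => ?_
  rw [Real.norm_eq_abs, abs_le]
  have h1 := key (-η)
  rw [map_neg, norm_neg] at h1
  exact ⟨by linarith, key η⟩

theorem norm_gradient_eq_norm_fderiv {d : ℕ} (w : Euc d → ℝ) (x : Euc d) :
    ‖gradient w x‖ = ‖fderiv ℝ w x‖ := by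
  simp [gradient]

theorem norm_le_sqrt_of_abs_le_one {d : ℕ} {z : Euc d} (h : ∀ i, |z i| ≤ 1) :
    ‖z‖ ≤ √d := by
  rw [EuclideanSpace.norm_eq]
  refine Real.sqrt_le_sqrt ?_
  calc ∑ i, ‖z i‖ ^ 2 ≤ ∑ _i : Fin d, (1 : ℝ) :=
        Finset.sum_le_sum fun i _ => pow_le_one₀ (norm_nonneg _) (h i)
    _ = d := by simp

theorem exists_max_doubled {d : ℕ} {w : Euc d → ℝ} (hw : Continuous w)
    (hper : ∀ (y : Euc d) (k : Fin d → ℤ), w (y + WithLp.toLp 2 fun i => (k i : ℝ)) = w y)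
    {φ : ℝ → ℝ} (hφ : Continuous φ) (hmono : Monotone φ) :
    ∃ x y : Euc d, ‖x - y‖ ≤ √d ∧
      ∀ x' y', w x' - w y' - φ ‖x' - y'‖ ≤ w x - w y - φ ‖x - y‖ := by
  set B : Set (Euc d) := closedBall 0 √d
  have hB : IsCompact (B ×ˢ B) := (isCompact_closedBall _ _).prod (isCompact_closedBall _ _)
  have hcont : Continuous fun z : Euc d × Euc d => w (z.1 + z.2) - w z.1 - φ ‖z.2‖ := by
    fun_prop
  obtain ⟨⟨y, z⟩, hyz, hm⟩ :=
    hB.exists_isMaxOn ⟨(0, 0), by simp [B]⟩ hcont.continuousOn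
  refine ⟨y + z, y, by simpa [B] using hyz.2, fun x' y' => ?_⟩
  have hper' : ∀ (y : Euc d) (k : Fin d → ℤ),
      w (y - WithLp.toLp 2 fun i => (k i : ℝ)) = w y := fun y k => by
    rw [← hper (y - _) k, sub_add_cancel]
  set kz : Fin d → ℤ := fun i => round ((x' - y') i)
  set ky : Fin d → ℤ := fun i => round (y' i)
  set z₁ : Euc d := (x' - y') - WithLp.toLp 2 fun i => (kz i : ℝ) with hz₁
  set y₁ : Euc d := y' - WithLp.toLp 2 fun i => (ky i : ℝ) with hy₁
  have hz_norm : ‖z₁‖ ≤ ‖x' - y'‖ := by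
    rw [EuclideanSpace.norm_eq, EuclideanSpace.norm_eq]
    refine Real.sqrt_le_sqrt (Finset.sum_le_sum fun i _ => ?_)
    refine pow_le_pow_left₀ (norm_nonneg _) ?_ 2
    simpa [hz₁, kz] using round_le ((x' - y') i) 0
  have hzB : z₁ ∈ B := by
    rw [mem_closedBall_zero_iff]
    refine norm_le_sqrt_of_abs_le_one fun i => ?_
    have := abs_sub_round ((x' - y') i)
    simp only [hz₁, kz, PiLp.sub_apply] at this ⊢
    linarith
  have hyB : y₁ ∈ B := by
    rw [mem_closedBall_zero_iff]
    refine norm_le_sqrt_of_abs_le_one fun i => ?_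
    have := abs_sub_round (y' i)
    simp only [hy₁, ky, PiLp.sub_apply] at this ⊢
    linarith
  have h := hm (Set.mk_mem_prod hyB hzB)
  simp only [Set.mem_ofPred_eq] at h
  have e1 : w y₁ = w y' := hper' _ _
  have e2 : w (y₁ + z₁) = w x' := by
    rw [show y₁ + z₁ = x' - (WithLp.toLp 2 fun i => (kz i : ℝ)) - WithLp.toLp 2 fun i => (ky i : ℝ)
      by rw [hy₁, hz₁]; abel, hper', hper']
  rw [e1, e2] at h
  rw [add_sub_cancel_left]
  linarith [hmono hz_norm]

/-- Oscillation bound for periodic solutions of `δ w - tr(a D²w) + G(y, Dw) = 0` with `G` of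
linear growth in the gradient, uniformly in the discount `δ`. -/
theorem exists_oscillation_bound {d : ℕ} {a : Matrix (Fin d) (Fin d) ℝ} (ha : a.PosDef)
    (haS : a.IsSymm) {M : ℝ} (hM : 0 ≤ M) :
    ∃ k : ℝ, 0 < k ∧ ∀ δ : ℝ, 0 < δ → ∀ Λ : ℝ, 0 < Λ → ∀ w : Euc d → ℝ, ContDiff ℝ 2 w →
      (∀ (y : Euc d) (k : Fin d → ℤ), w (y + WithLp.toLp 2 fun i => (k i : ℝ)) = w y) →
      ∀ G : Euc d → Euc d → ℝ, (∀ y q, |G y q| ≤ Λ + M * ‖q‖) →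
      (∀ y, δ * w y - trAH a w y + G y (gradient w y) = 0) →
      ∀ x y, w x - w y ≤ k * Λ := by
  obtain ⟨κ, hκ0, hκ⟩ := exists_pos_mul_sq_norm_le ha
  set m : ℝ := (M + 1) / (2 * κ) with hm
  have hm0 : 0 < m := by positivity
  have hκm : 2 * κ * m = M + 1 := by rw [hm]; field_simp
  refine ⟨Real.exp (m * √d) / m, by positivity, ?_⟩
  intro δ hδ Λ hΛ w hw hper G hG heq x' y'
  set b : ℝ := Real.exp (m * √d) / m * Λ with hb
  have hb0 : 0 < b := by positivity
  set φ : ℝ → ℝ := fun t => b * (1 - Real.exp (-(m * t))) with hφdef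
  set φ' : ℝ → ℝ := fun t => b * m * Real.exp (-(m * t)) with hφ'def
  have hexp : ∀ t, HasDerivAt (fun t : ℝ => Real.exp (-(m * t)))
      (Real.exp (-(m * t)) * -m) t := fun t => by
    simpa using (((hasDerivAt_id t).const_mul m).neg).exp
  have hφ : ∀ t, HasDerivAt φ (φ' t) t := fun t => by
    have := ((hexp t).const_sub 1).const_mul b
    refine this.congr_deriv ?_
    simp only [hφ'def]; ring
  have hφ' : ∀ t, HasDerivAt φ' (-m * φ' t) t := fun t => by
    refine ((hexp t).const_mul (b * m)).congr_deriv ?_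
    simp only [hφ'def]; ring
  have hφ'0 : ∀ t, 0 < φ' t := fun t => by positivity
  have hmono : Monotone φ :=
    monotone_of_hasDerivAt_nonneg hφ fun t => (hφ'0 t).le
  have hφ0 : φ 0 = 0 := by simp [hφdef]
  have hφb : ∀ t, φ t ≤ b := fun t => by
    have := mul_pos hb0 (Real.exp_pos (-(m * t)))
    simp only [hφdef]; linarith
  have htan : ∀ s t, φ s - φ t ≤ φ' t * |s - t| := fun s t => by
    have h1 : Real.exp (-(m * s)) = Real.exp (-(m * t)) * Real.exp (-(m * (s - t))) := by
      rw [← Real.exp_add]; congr 1; ring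
    have h2 := Real.add_one_le_exp (-(m * (s - t)))
    have h3 : φ s - φ t ≤ φ' t * (s - t) := by
      simp only [hφdef, hφ'def]
      rw [h1]
      nlinarith [mul_le_mul_of_nonneg_left h2 (mul_pos hb0 (Real.exp_pos (-(m * t)))).le]
    exact h3.trans (mul_le_mul_of_nonneg_left (le_abs_self _) (hφ'0 t).le)
  by_contra! hcon
  obtain ⟨x, y, hR, hmax⟩ := exists_max_doubled hw.continuous hper
    (continuous_iff_continuousAt.2 fun t => (hφ t).continuousAt) hmono
  have hpos : φ ‖x - y‖ < w x - w y := by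
    linarith [hmax x' y', hφb ‖x' - y'‖]
  have hφr : 0 ≤ φ ‖x - y‖ := hφ0 ▸ hmono (norm_nonneg _)
  have hxy : x ≠ y := by
    rintro rfl
    simp [hφ0] at hpos
  have htr := trAH_sub_trAH_le haS hκ0.le hκ hw hxy hφ (hφ' _) hmax
  have hdiff : Differentiable ℝ w := hw.differentiable (by simp)
  have hgx : ‖gradient w x‖ ≤ φ' ‖x - y‖ := by
    rw [norm_gradient_eq_norm_fderiv]
    refine norm_fderiv_le_of_sub_le (hφ'0 _).le (hdiff x) fun z => ?_
    have h1 := hmax z y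
    have h2 := htan ‖z - y‖ ‖x - y‖
    have h3 : |‖z - y‖ - ‖x - y‖| ≤ ‖z - x‖ := by
      simpa using abs_norm_sub_norm_le (z - y) (x - y)
    have h4 := mul_le_mul_of_nonneg_left h3 (hφ'0 ‖x - y‖).le
    linarith
  have hgy : ‖gradient w y‖ ≤ φ' ‖x - y‖ := by
    rw [norm_gradient_eq_norm_fderiv, ← norm_neg, ← fderiv_fun_neg]
    refine norm_fderiv_le_of_sub_le (hφ'0 _).le (hdiff y).fun_neg fun z => ?_
    have h1 := hmax x z
    have h2 := htan ‖x - z‖ ‖x - y‖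
    have h3 : |‖x - z‖ - ‖x - y‖| ≤ ‖z - y‖ := by
      have := abs_norm_sub_norm_le (x - z) (x - y)
      rwa [sub_sub_sub_cancel_left, norm_sub_rev y z] at this
    have h4 := mul_le_mul_of_nonneg_left h3 (hφ'0 ‖x - y‖).le
    linarith
  have hφΛ : Λ ≤ φ' ‖x - y‖ := by
    have h1 : φ' ‖x - y‖ = Λ * Real.exp (m * (√d - ‖x - y‖)) := by
      simp only [hφ'def, hb]
      rw [mul_sub, sub_eq_add_neg (m * √d), Real.exp_add]
      field_simp
    rw [h1]
    exact le_mul_of_one_le_right hΛ.le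
      (Real.one_le_exp (mul_nonneg hm0.le (sub_nonneg.2 hR)))
  have hGx := neg_le_of_abs_le (hG x (gradient w x))
  have hGy := le_of_abs_le (hG y (gradient w y))
  have hMx := mul_le_mul_of_nonneg_left hgx hM
  have hMy := mul_le_mul_of_nonneg_left hgy hM
  have hδ' : 0 < δ * (w x - w y) := mul_pos hδ (by linarith)
  have hcoef : 4 * κ * (-m * φ' ‖x - y‖) = -(2 * M + 2) * φ' ‖x - y‖ := by
    rw [show 4 * κ * (-m * φ' ‖x - y‖) = -2 * (2 * κ * m) * φ' ‖x - y‖ by ring, hκm]; ring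
  rw [hcoef] at htr
  linarith [heq x, heq y]

theorem tlift_add_int {d : ℕ} (v : Torus d → ℝ) (y : Euc d) (k : Fin d → ℤ) :
    tlift v (y + WithLp.toLp 2 fun i => (k i : ℝ)) = tlift v y := by
  unfold tlift
  congr 1
  ext i
  simp [Torus.proj]

theorem Torus.proj_surjective {d : ℕ} : Function.Surjective (Torus.proj (d := d)) := by
  intro y
  choose z hz using fun i => QuotientAddGroup.mk_surjective (y i)
  exact ⟨WithLp.toLp 2 z, funext hz⟩

theorem W1T_le {d : ℕ} {D : ℝ} (hD : ∀ x y : Torus d, dist x y ≤ D) (μ ν : ProbT d) :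
    W1T μ ν ≤ D := by
  have hbdd : BddBelow (Set.range fun π : {π : Measure (Torus d × Torus d) //
      IsProbabilityMeasure π ∧ π.map Prod.fst = (μ : Measure (Torus d)) ∧
        π.map Prod.snd = (ν : Measure (Torus d))} =>
      ∫ z, dist z.1 z.2 ∂(π : Measure (Torus d × Torus d))) :=
    ⟨0, by rintro _ ⟨π, rfl⟩; exact integral_nonneg fun _ => dist_nonneg⟩
  refine (ciInf_le hbdd ⟨(μ : Measure (Torus d)).prod (ν : Measure (Torus d)),
    inferInstance, by simp, by simp⟩).trans ?_
  refine (le_abs_self _).trans ?_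
  simpa using norm_integral_le_of_norm_le_const (C := D)
    (μ := (μ : Measure (Torus d)).prod (ν : Measure (Torus d)))
    (f := fun z : Torus d × Torus d => dist z.1 z.2)
    (Eventually.of_forall fun z => by simpa using hD z.1 z.2)

theorem W1T_nonneg {d : ℕ} (μ ν : ProbT d) : 0 ≤ W1T μ ν :=
  Real.iInf_nonneg fun _ => integral_nonneg fun _ => dist_nonneg

theorem abs_sSup_image_sub_le {X : Type*} {A : Set X} {g h : X → ℝ} {c : ℝ} (hc : 0 ≤ c)
    (hg : BddAbove (g '' A)) (hh : BddAbove (h '' A)) (hgh : ∀ α ∈ A, |g α - h α| ≤ c) :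
    |sSup (g '' A) - sSup (h '' A)| ≤ c := by
  rcases A.eq_empty_or_nonempty with rfl | hne
  · simpa using hc
  have h1 : sSup (g '' A) ≤ sSup (h '' A) + c := by
    refine csSup_le (hne.image g) ?_
    rintro _ ⟨α, hα, rfl⟩
    linarith [le_csSup hh (Set.mem_image_of_mem h hα), le_of_abs_le (hgh α hα)]
  have h2 : sSup (h '' A) ≤ sSup (g '' A) + c := by
    refine csSup_le (hne.image h) ?_
    rintro _ ⟨α, hα, rfl⟩
    linarith [le_csSup hg (Set.mem_image_of_mem g hα), neg_le_of_abs_le (hgh α hα)]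
  rw [abs_le]
  constructor <;> linarith

/-- There exists a constant `C > 0`, independent of `δ, x, p, μ`, such that
every classical solution `v` of the discounted cell problem satisfies
`sup_y |v(y) − v(0)| ≤ C (1 + λ(p) + |p|)`, where `λ(p) = sup_{x,y,μ} |H(x,y,p,0,μ)|`. -/
theorem oscillation_bound_discounted_solution (d : ℕ)
    -- `a = σ₂σ₂ᵀ + σ_{0,2}σ_{0,2}ᵀ` is a constant symmetric positive definite matrix
    (a : Matrix (Fin d) (Fin d) ℝ) (ha : a.PosDef) (haS : a.IsSymm)
    -- `A ⊂ ℝ^{2d}` is a compact set of controls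
    (A : Set (Euc (2*d))) (hA : IsCompact A)
    -- the data `c, f, L`, continuous and Lipschitz in `(x,y,μ)` uniformly in `α ∈ A`
    (c f : Torus d → Torus d → Euc (2*d) → ProbT d → Euc d)
    (L : Torus d → Torus d → Euc (2*d) → ProbT d → ℝ)
    (hccont : ∀ μ, Continuous fun z : Torus d × Torus d × Euc (2*d) => c z.1 z.2.1 z.2.2 μ)
    (hfcont : ∀ μ, Continuous fun z : Torus d × Torus d × Euc (2*d) => f z.1 z.2.1 z.2.2 μ)
    (hLcont : ∀ μ, Continuous fun z : Torus d × Torus d × Euc (2*d) => L z.1 z.2.1 z.2.2 μ)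
    (K : ℝ)
    (hclip : ∀ x x' y y' α μ μ', α ∈ A →
      ‖c x y α μ - c x' y' α μ'‖ ≤ K * (dist x x' + dist y y' + W1T μ μ'))
    (hflip : ∀ x x' y y' α μ μ', α ∈ A →
      ‖f x y α μ - f x' y' α μ'‖ ≤ K * (dist x x' + dist y y' + W1T μ μ'))
    (hLlip : ∀ x x' y y' α μ μ', α ∈ A →
      |L x y α μ - L x' y' α μ'| ≤ K * (dist x x' + dist y y' + W1T μ μ'))
    -- the Bellman Hamiltonian
    (H : Torus d → Torus d → Euc d → Euc d → ProbT d → ℝ)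
    (hHdef : ∀ x y p q μ,
      H x y p q μ =
        sSup ((fun α => -⟪p, c x y α μ⟫ - ⟪q, f x y α μ⟫ - L x y α μ) '' A))
    (C_H β : ℝ) (hβ0 : 0 < β) (hβ1 : β < 1)
    -- (A3)(2): global Lipschitz-type estimate for `H`
    (hHlip : ∀ x x' y y' p p' q q' μ μ',
      |H x y p q μ - H x' y' p' q' μ'| ≤
        C_H * (1 + ‖p‖ + ‖q‖ + ‖p'‖ + ‖q'‖) *
          (dist x x' + dist y y' + ‖p - p'‖ + ‖q - q'‖ + W1T μ μ'))
    -- (A3)(3): for each `μ`, `(x,y,p,q) ↦ H` is C²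
    (hHC2 : ∀ μ, ContDiff ℝ 2
      (fun z : Euc d × Euc d × Euc d × Euc d =>
        H (Torus.proj z.1) (Torus.proj z.2.1) z.2.2.1 z.2.2.2 μ))
    -- with second derivative locally β-Hölder continuous uniformly in `μ`
    (hHholder : ∀ R : ℝ, 0 < R → ∃ C : ℝ, ∀ μ, ∀ z z' : Euc d × Euc d × Euc d × Euc d,
      ‖z‖ ≤ R → ‖z'‖ ≤ R →
      ‖iteratedFDeriv ℝ 2 (fun w : Euc d × Euc d × Euc d × Euc d =>
          H (Torus.proj w.1) (Torus.proj w.2.1) w.2.2.1 w.2.2.2 μ) z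
        - iteratedFDeriv ℝ 2 (fun w : Euc d × Euc d × Euc d × Euc d =>
          H (Torus.proj w.1) (Torus.proj w.2.1) w.2.2.1 w.2.2.2 μ) z'‖
        ≤ C * ‖z - z'‖ ^ β)
    -- `|D_x H| ≤ C_H (1+|p|)` and `|D_p H| ≤ C_H (1+|p|)`
    (hDx : ∀ (x : Euc d) (y : Torus d) (p q : Euc d) (μ : ProbT d),
      ‖fderiv ℝ (fun x' : Euc d => H (Torus.proj x') y p q μ) x‖ ≤ C_H * (1 + ‖p‖))
    (hDp : ∀ (x y : Torus d) (p q : Euc d) (μ : ProbT d),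
      ‖fderiv ℝ (fun p' : Euc d => H x y p' q μ) p‖ ≤ C_H * (1 + ‖p‖))
    :
    ∃ C : ℝ, 0 < C ∧
      ∀ δ : ℝ, 0 < δ → ∀ (x : Torus d) (p : Euc d) (μ : ProbT d) (v : Torus d → ℝ),
        IsSol a H δ x p μ v →
        (⨆ y : Torus d, |v y - v (Torus.proj 0)|) ≤
          C * (1 + (⨆ t : Torus d × Torus d × ProbT d, |H t.1 t.2.1 p 0 t.2.2|) + ‖p‖) := by
  obtain ⟨D, hD⟩ : ∃ D : ℝ, ∀ x y : Torus d, dist x y ≤ D :=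
    ⟨Metric.diam (Set.univ : Set (Torus d)), fun x y =>
      Metric.dist_le_diam_of_mem isCompact_univ.isBounded (Set.mem_univ _) (Set.mem_univ _)⟩
  let x₀ : Torus d := Torus.proj 0
  let μ₀ : ProbT d := ⟨Measure.dirac x₀, inferInstance⟩
  have hsum0 : ∀ (x x' y y' : Torus d) (μ μ' : ProbT d),
      0 ≤ dist x x' + dist y y' + W1T μ μ' := fun x x' y y' μ μ' =>
    add_nonneg (add_nonneg dist_nonneg dist_nonneg) (W1T_nonneg _ _)
  have hsum : ∀ (x x' y y' : Torus d) (μ μ' : ProbT d),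
      dist x x' + dist y y' + W1T μ μ' ≤ 3 * D := fun x x' y y' μ μ' => by
    linarith [hD x x', hD y y', W1T_le hD μ μ']
  have hlip_le : ∀ (c : ℝ) (x x' y y' : Torus d) (μ μ' : ProbT d),
      c * (dist x x' + dist y y' + W1T μ μ') ≤ |c| * (3 * D) := fun c x x' y y' μ μ' =>
    (mul_le_mul_of_nonneg_right (le_abs_self c) (hsum0 x x' y y' μ μ')).trans
      (mul_le_mul_of_nonneg_left (hsum x x' y y' μ μ') (abs_nonneg c))
  obtain ⟨M, hM0, hM⟩ : ∃ M : ℝ, 0 ≤ M ∧ ∀ x y α μ, α ∈ A → ‖f x y α μ‖ ≤ M := by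
    have hcont : Continuous fun α => f x₀ x₀ α μ₀ :=
      (hfcont μ₀).comp (continuous_const.prodMk (continuous_const.prodMk continuous_id))
    obtain ⟨B, hB⟩ := hA.exists_bound_of_continuousOn hcont.continuousOn
    refine ⟨|B + |K| * (3 * D)|, abs_nonneg _, fun x y α μ hα => ?_⟩
    have h1 := (hflip x x₀ y x₀ α μ μ₀ hα).trans (hlip_le K x x₀ y x₀ μ μ₀)
    have h2 := norm_le_norm_add_norm_sub' (f x y α μ) (f x₀ x₀ α μ₀)
    refine le_trans ?_ (le_abs_self _)
    linarith [hB α hα]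
  have hHq : ∀ x y p q μ, |H x y p q μ - H x y p 0 μ| ≤ M * ‖q‖ := by
    intro x y p q μ
    have hbdd : ∀ q : Euc d, BddAbove
        ((fun α => -⟪p, c x y α μ⟫ - ⟪q, f x y α μ⟫ - L x y α μ) '' A) := fun q => by
      have hα : Continuous fun α : Euc (2 * d) => (x, y, α) := by fun_prop
      have h1 := (hccont μ).comp hα
      have h2 := (hfcont μ).comp hα
      have h3 := (hLcont μ).comp hα
      refine (hA.image ?_).bddAbove
      exact (((continuous_const.inner h1).neg).sub (continuous_const.inner h2)).sub h3
    rw [hHdef, hHdef]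
    refine abs_sSup_image_sub_le (by positivity) (hbdd q) (hbdd 0) fun α hα => ?_
    rw [show -⟪p, c x y α μ⟫ - ⟪q, f x y α μ⟫ - L x y α μ
      - (-⟪p, c x y α μ⟫ - ⟪(0 : Euc d), f x y α μ⟫ - L x y α μ) = -⟪q, f x y α μ⟫ by
        rw [inner_zero_left]; ring, abs_neg, mul_comm]
    exact (abs_real_inner_le_norm _ _).trans
      (mul_le_mul_of_nonneg_left (hM x y α μ hα) (norm_nonneg _))
  have hbdd : ∀ p, BddAbove
      (Set.range fun t : Torus d × Torus d × ProbT d => |H t.1 t.2.1 p 0 t.2.2|) := by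
    intro p
    refine ⟨|H x₀ x₀ p 0 μ₀| + |C_H * (1 + ‖p‖ + ‖p‖)| * (3 * D), ?_⟩
    rintro _ ⟨⟨x, y, μ⟩, rfl⟩
    have h1 := hHlip x x₀ y x₀ p p 0 0 μ μ₀
    simp only [norm_zero, sub_self, add_zero] at h1
    have h2 := h1.trans (hlip_le _ x x₀ y x₀ μ μ₀)
    have h3 := abs_sub_abs_le_abs_sub (H x y p 0 μ) (H x₀ x₀ p 0 μ₀)
    simp only
    linarith
  obtain ⟨k, hk, hosc⟩ := exists_oscillation_bound ha haS hM0
  refine ⟨k, hk, fun δ hδ x p μ v hv => ?_⟩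
  set lam : ℝ := ⨆ t : Torus d × Torus d × ProbT d, |H t.1 t.2.1 p 0 t.2.2| with hlam
  have hlam0 : 0 ≤ lam := Real.iSup_nonneg fun _ => abs_nonneg _
  have hmain := hosc δ hδ (1 + lam) (by linarith) (tlift v) hv.1 (tlift_add_int v)
    (fun y q => H x (Torus.proj y) p q μ) (fun y q => by
      have h1 := hHq x (Torus.proj y) p q μ
      have h2 : |H x (Torus.proj y) p 0 μ| ≤ lam := le_ciSup (hbdd p) (x, Torus.proj y, μ)
      have h3 := abs_sub_abs_le_abs_sub (H x (Torus.proj y) p q μ) (H x (Torus.proj y) p 0 μ)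
      linarith) hv.2
  refine ciSup_le fun y => ?_
  obtain ⟨z, rfl⟩ := Torus.proj_surjective y
  have h1 := hmain z 0
  have h2 := hmain 0 z
  simp only [tlift] at h1 h2
  have h3 : k * (1 + lam) ≤ k * (1 + lam + ‖p‖) :=
    mul_le_mul_of_nonneg_left (by linarith [norm_nonneg p]) hk.le
  rw [abs_le]
  constructor <;> linarith
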